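/- Two orbifold atlases of dimension n on a space X are equivalent (i.e. equivalent at every point x ∈ X, meaning some uniformizing system around x embeds into a chart of each atlas) if and only if they admit a common refinement, where an atlas W refines an atlas V on X iff every uniformizing system of W admits an embedding into some uniformizing system of V. -/

import Mathlib

open Set

noncomputable section

/-- `ℂⁿ`. -/
abbrev CC (n : ℕ) : Type := EuclideanSpace ℂ (Fin n)

/-- A (reduced complex) uniformizing system of dimension `n` for the open set
`U := p '' Ut` of `X`: `Ut ⊆ ℂⁿ` is a nonempty connected open set, `G` is a finite
group of holomorphic automorphisms of `Ut` (encoded as total maps that agree with the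
identity outside `Ut`, so that `G` is honestly a set of maps closed under composition
and inversion), and `p` (the map `π`) is continuous, surjective and `G`-invariant on
`Ut`, inducing a homeomorphism `Ut/G ≃ U` (encoded by: the fibres of `p` on `Ut` are
exactly the `G`-orbits and `p` is an open map on `Ut`). -/
structure UniformizingSystem (n : ℕ) (X : Type*) [TopologicalSpace X] where
  Ut : Set (CC n)
  isOpen_Ut : IsOpen Ut
  isConnected_Ut : IsConnected Ut
  G : Set (CC n → CC n)
  finite_G : G.Finite
  id_mem_G : (id : CC n → CC n) ∈ G
  comp_mem_G : ∀ g ∈ G, ∀ h ∈ G, (g ∘ h) ∈ G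
  inv_mem_G : ∀ g ∈ G, ∃ g' ∈ G, (∀ x, g' (g x) = x) ∧ (∀ x, g (g' x) = x)
  mapsTo_G : ∀ g ∈ G, Set.MapsTo g Ut Ut
  eqOn_id_G : ∀ g ∈ G, Set.EqOn g id Utᶜ
  analytic_G : ∀ g ∈ G, AnalyticOnNhd ℂ g Ut
  p : CC n → X
  continuousOn_p : ContinuousOn p Ut
  isOpen_image_p : IsOpen (p '' Ut)
  invariant_p : ∀ g ∈ G, ∀ x ∈ Ut, p (g x) = p x
  exists_g_of_p_eq : ∀ x ∈ Ut, ∀ y ∈ Ut, p x = p y → ∃ g ∈ G, g x = y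
  isOpenMap_p : ∀ V : Set (CC n), V ⊆ Ut → IsOpen V → IsOpen (p '' V)

/-- The underlying open subset of `X` uniformized by the system. -/
def UniformizingSystem.U {n : ℕ} {X : Type*} [TopologicalSpace X]
    (𝒰 : UniformizingSystem n X) : Set X := 𝒰.p '' 𝒰.Ut

/-- An embedding `l : (Ũ,G,π) → (Ṽ,H,φ)` of uniformizing systems: a holomorphic
embedding (injective, biholomorphism onto its open image) with `φ ∘ l = π` on `Ũ`. -/
structure IsUSEmbedding {n : ℕ} {X : Type*} [TopologicalSpace X]
    (𝒰 𝒱 : UniformizingSystem n X) (l : CC n → CC n) : Prop where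
  mapsTo : Set.MapsTo l 𝒰.Ut 𝒱.Ut
  injOn : Set.InjOn l 𝒰.Ut
  analyticOn : AnalyticOnNhd ℂ l 𝒰.Ut
  isOpen_image : IsOpen (l '' 𝒰.Ut)
  exists_analytic_inv : ∃ m : CC n → CC n,
    AnalyticOnNhd ℂ m (l '' 𝒰.Ut) ∧ ∀ x ∈ 𝒰.Ut, m (l x) = x
  comp_p : ∀ x ∈ 𝒰.Ut, 𝒱.p (l x) = 𝒰.p x

/-- A (reduced complex) orbifold atlas of dimension `n` on `X`: a family of
uniformizing systems whose underlying open sets cover `X`, such that any two charts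
are compatible at every point of the intersection of their underlying open sets. -/
structure OrbifoldAtlas (n : ℕ) (X : Type*) [TopologicalSpace X] where
  I : Type
  chart : I → UniformizingSystem n X
  covers : ∀ x : X, ∃ i : I, x ∈ (chart i).U
  compat : ∀ i j : I, ∀ x ∈ (chart i).U ∩ (chart j).U,
    ∃ k : I, x ∈ (chart k).U ∧ (chart k).U ⊆ (chart i).U ∩ (chart j).U ∧
      (∃ l, IsUSEmbedding (chart k) (chart i) l) ∧
      (∃ l, IsUSEmbedding (chart k) (chart j) l)

/-- Two orbifold atlases on `X` are equivalent at `x ∈ X` iff some uniformizing system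
whose underlying open set contains `x` embeds into a chart of each atlas. -/
def AtlasEquivAt {n : ℕ} {X : Type*} [TopologicalSpace X]
    (𝒰 𝒱 : OrbifoldAtlas n X) (x : X) : Prop :=
  ∃ (W : UniformizingSystem n X) (i : 𝒰.I) (j : 𝒱.I) (l l' : CC n → CC n),
    x ∈ W.U ∧ IsUSEmbedding W (𝒰.chart i) l ∧ IsUSEmbedding W (𝒱.chart j) l'

/-- Two orbifold atlases on `X` are equivalent iff they are equivalent at every point. -/
def AtlasEquiv {n : ℕ} {X : Type*} [TopologicalSpace X]
    (𝒰 𝒱 : OrbifoldAtlas n X) : Prop :=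
  ∀ x : X, AtlasEquivAt 𝒰 𝒱 x

/-- The atlas `𝒲` refines the atlas `𝒱` iff every uniformizing system of `𝒲` admits
an embedding into some uniformizing system of `𝒱`. -/
def Refines {n : ℕ} {X : Type*} [TopologicalSpace X]
    (𝒲 𝒱 : OrbifoldAtlas n X) : Prop :=
  ∀ i : 𝒲.I, ∃ (j : 𝒱.I) (l : CC n → CC n), IsUSEmbedding (𝒲.chart i) (𝒱.chart j) l

namespace UniformizingSystem

variable {n : ℕ} {X : Type*} [TopologicalSpace X]

/-- Around every point of a chart there are arbitrarily small open connected sets that are stable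
under the stabilizer of the point and disjoint from their translates by all other group
elements. -/
lemma exists_isOpen_stable (P : UniformizingSystem n X) {q : CC n} (hq : q ∈ P.Ut)
    {N : Set (CC n)} (hN : IsOpen N) (hqN : q ∈ N) :
    ∃ S : Set (CC n), IsOpen S ∧ IsConnected S ∧ q ∈ S ∧ S ⊆ N ∧ S ⊆ P.Ut ∧
      (∀ g ∈ P.G, g q = q → MapsTo g S S) ∧
      ∀ g ∈ P.G, ∀ x ∈ S, g x ∈ S → g q = q := by
  classical
  have hcont : ∀ g ∈ P.G, ContinuousOn g P.Ut := fun g hg => (P.analytic_G g hg).continuousOn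
  have hsep : ∀ g ∈ P.G, ∃ O : Set (CC n), IsOpen O ∧ q ∈ O ∧ O ⊆ N ∩ P.Ut ∧
      (g q ≠ q → ∀ x ∈ O, g x ∉ O) := by
    intro g hg
    by_cases hgq : g q = q
    · exact ⟨N ∩ P.Ut, hN.inter P.isOpen_Ut, ⟨hqN, hq⟩, subset_rfl, fun h => absurd hgq h⟩
    · obtain ⟨A, B, hA, hB, hgA, hqB, hAB⟩ := t2_separation hgq
      refine ⟨N ∩ B ∩ (P.Ut ∩ g ⁻¹' A), (hN.inter hB).inter
        ((hcont g hg).isOpen_inter_preimage P.isOpen_Ut hA), ⟨⟨hqN, hqB⟩, hq, hgA⟩,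
        fun x hx => ⟨hx.1.1, hx.2.1⟩, fun _ x hx hgx => ?_⟩
      exact disjoint_left.mp hAB hx.2.2 hgx.1.2
  choose! O hO hqO hON hOsep using hsep
  set V : Set (CC n) := ⋂ g ∈ P.G, O g
  have hVO : IsOpen V := P.finite_G.isOpen_biInter hO
  have hVsub : V ⊆ N ∩ P.Ut := fun x hx => hON id P.id_mem_G (mem_iInter₂.mp hx id P.id_mem_G)
  set H : Set (CC n → CC n) := {g ∈ P.G | g q = q}
  set T : Set (CC n) := ⋂ g ∈ H, (P.Ut ∩ g ⁻¹' V)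
  have hTO : IsOpen T := (P.finite_G.subset (sep_subset _ _)).isOpen_biInter fun g hg =>
    (hcont g hg.1).isOpen_inter_preimage P.isOpen_Ut hVO
  have hqV : q ∈ V := mem_iInter₂.mpr hqO
  have hqT : q ∈ T := mem_iInter₂.mpr fun g hg => ⟨hq, by rw [mem_preimage, hg.2]; exact hqV⟩
  have hTV : T ⊆ V := fun x hx => (mem_iInter₂.mp hx id ⟨P.id_mem_G, rfl⟩).2
  have hTinv : ∀ g ∈ H, MapsTo g T T := by
    intro g hg x hx
    refine mem_iInter₂.mpr fun h hh => ⟨P.mapsTo_G g hg.1 (hVsub (hTV hx)).2, ?_⟩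
    exact (mem_iInter₂.mp hx (h ∘ g)
      ⟨P.comp_mem_G h hh.1 g hg.1, by rw [Function.comp_apply, hg.2, hh.2]⟩).2
  have hST : connectedComponentIn T q ⊆ T := connectedComponentIn_subset T q
  refine ⟨connectedComponentIn T q, hTO.connectedComponentIn,
    isConnected_connectedComponentIn_iff.mpr hqT, mem_connectedComponentIn hqT,
    fun x hx => (hVsub (hTV (hST hx))).1, fun x hx => (hVsub (hTV (hST hx))).2, ?_, ?_⟩
  · intro g hg hgq
    rw [mapsTo_iff_image_subset]
    refine IsPreconnected.subset_connectedComponentIn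
      (isPreconnected_connectedComponentIn.image g ((hcont g hg).mono
        fun x hx => (hVsub (hTV (hST hx))).2))
      ⟨q, mem_connectedComponentIn hqT, hgq⟩ ?_
    exact ((hTinv g ⟨hg, hgq⟩).mono_left hST).image_subset
  · intro g hg x hx hgx
    by_contra hgq
    exact hOsep g hg hgq x (mem_iInter₂.mp (hTV (hST hx)) g hg)
      (mem_iInter₂.mp (hTV (hST hgx)) g hg)

/-- Every point of a chart has arbitrarily small neighbourhoods on which the chart restricts to a
uniformizing system. -/
theorem exists_restriction (P : UniformizingSystem n X) {q : CC n} (hq : q ∈ P.Ut)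
    {N : Set (CC n)} (hN : IsOpen N) (hqN : q ∈ N) :
    ∃ W : UniformizingSystem n X, q ∈ W.Ut ∧ W.Ut ⊆ N ∧ W.Ut ⊆ P.Ut ∧ W.p = P.p := by
  classical
  obtain ⟨S, hSo, hSc, hqS, hSN, hSP, hstab, hdisj⟩ := P.exists_isOpen_stable hq hN hqN
  let r : (CC n → CC n) → CC n → CC n := fun g => S.piecewise g id
  have r_mem : ∀ g, ∀ x ∈ S, r g x = g x := fun g x hx => piecewise_eq_of_mem _ _ _ hx
  have r_notMem : ∀ g, ∀ x ∉ S, r g x = x := fun g x hx => piecewise_eq_of_notMem _ _ _ hx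
  have r_comp : ∀ g h, MapsTo h S S → r g ∘ r h = r (g ∘ h) := by
    intro g h hh
    ext1 x
    by_cases hx : x ∈ S
    · simp only [Function.comp_apply, r_mem _ x hx, r_mem _ _ (hh hx)]
    · simp only [Function.comp_apply, r_notMem _ x hx]
  have r_id : r id = id := piecewise_same _ _
  refine ⟨
    { Ut := S
      isOpen_Ut := hSo
      isConnected_Ut := hSc
      G := r '' {g ∈ P.G | g q = q}
      finite_G := (P.finite_G.subset (sep_subset _ _)).image _
      id_mem_G := ⟨id, ⟨P.id_mem_G, rfl⟩, r_id⟩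
      comp_mem_G := ?_
      inv_mem_G := ?_
      mapsTo_G := ?_
      eqOn_id_G := ?_
      analytic_G := ?_
      p := P.p
      continuousOn_p := P.continuousOn_p.mono hSP
      isOpen_image_p := P.isOpenMap_p S hSP hSo
      invariant_p := ?_
      exists_g_of_p_eq := ?_
      isOpenMap_p := fun V hV hVo => P.isOpenMap_p V (hV.trans hSP) hVo },
    hqS, hSN, hSP, rfl⟩
  · rintro _ ⟨g, hg, rfl⟩ _ ⟨h, hh, rfl⟩
    exact ⟨g ∘ h, ⟨P.comp_mem_G g hg.1 h hh.1, by rw [Function.comp_apply, hh.2, hg.2]⟩,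
      (r_comp g h (hstab h hh.1 hh.2)).symm⟩
  · rintro _ ⟨g, hg, rfl⟩
    obtain ⟨g', hg', hl, hr⟩ := P.inv_mem_G g hg.1
    have hq' : g' q = q := by simpa only [hg.2] using hl q
    refine ⟨r g', ⟨g', ⟨hg', hq'⟩, rfl⟩, fun x => ?_, fun x => ?_⟩
    · rw [← Function.comp_apply (f := r g'), r_comp g' g (hstab g hg.1 hg.2),
        show g' ∘ g = id from funext hl, r_id, id]
    · rw [← Function.comp_apply (f := r g), r_comp g g' (hstab g' hg' hq'),
        show g ∘ g' = id from funext hr, r_id, id]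
  · rintro _ ⟨g, hg, rfl⟩ x hx
    rw [r_mem g x hx]
    exact hstab g hg.1 hg.2 hx
  · rintro _ ⟨g, hg, rfl⟩ x hx
    exact r_notMem g x hx
  · rintro _ ⟨g, hg, rfl⟩
    exact ((P.analytic_G g hg.1).mono hSP).congr hSo fun x hx => (r_mem g x hx).symm
  · rintro _ ⟨g, hg, rfl⟩ x hx
    rw [r_mem g x hx]
    exact P.invariant_p g hg.1 x (hSP hx)
  · intro x hx y hy hxy
    obtain ⟨g, hg, rfl⟩ := P.exists_g_of_p_eq x (hSP hx) y (hSP hy) hxy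
    exact ⟨r g, ⟨g, ⟨hg, hdisj g hg x hx hy⟩, rfl⟩, r_mem g x hx⟩

end UniformizingSystem

namespace IsUSEmbedding

variable {n : ℕ} {X : Type*} [TopologicalSpace X] {A B C P : UniformizingSystem n X}
  {l m : CC n → CC n}

lemma isOpen_image_of_subset (hl : IsUSEmbedding A B l) {S : Set (CC n)} (hS : IsOpen S)
    (hSA : S ⊆ A.Ut) : IsOpen (l '' S) := by
  obtain ⟨k, hk, hkl⟩ := hl.exists_analytic_inv
  suffices h : l '' S = l '' A.Ut ∩ k ⁻¹' S from
    h ▸ hk.continuousOn.isOpen_inter_preimage hl.isOpen_image hS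
  ext y
  constructor
  · rintro ⟨x, hx, rfl⟩
    exact ⟨mem_image_of_mem l (hSA hx), by rwa [mem_preimage, hkl x (hSA hx)]⟩
  · rintro ⟨⟨x, hx, rfl⟩, hy⟩
    rw [mem_preimage, hkl x hx] at hy
    exact mem_image_of_mem l hy

lemma comp (hm : IsUSEmbedding B C m) (hl : IsUSEmbedding A B l) :
    IsUSEmbedding A C (m ∘ l) where
  mapsTo := hm.mapsTo.comp hl.mapsTo
  injOn := hm.injOn.comp hl.injOn hl.mapsTo
  analyticOn := hm.analyticOn.comp hl.analyticOn hl.mapsTo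
  isOpen_image := by
    rw [image_comp]
    exact hm.isOpen_image_of_subset hl.isOpen_image hl.mapsTo.image_subset
  exists_analytic_inv := by
    obtain ⟨k, hk, hkl⟩ := hl.exists_analytic_inv
    obtain ⟨k', hk', hkm⟩ := hm.exists_analytic_inv
    refine ⟨k ∘ k', hk.comp (hk'.mono ?_) ?_, fun x hx => ?_⟩
    · rw [image_comp]
      exact image_mono hl.mapsTo.image_subset
    · rintro _ ⟨x, hx, rfl⟩
      rw [Function.comp_apply, hkm _ (hl.mapsTo hx)]
      exact mem_image_of_mem l hx
    · simp only [Function.comp_apply, hkm _ (hl.mapsTo hx), hkl x hx]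
  comp_p := fun x hx => (hm.comp_p _ (hl.mapsTo hx)).trans (hl.comp_p x hx)

lemma U_subset (hl : IsUSEmbedding A B l) : A.U ⊆ B.U := by
  rintro _ ⟨x, hx, rfl⟩
  exact ⟨l x, hl.mapsTo hx, hl.comp_p x hx⟩

lemma of_subset (hAB : A.Ut ⊆ B.Ut) (hp : A.p = B.p) : IsUSEmbedding A B id where
  mapsTo := hAB
  injOn := injOn_id _
  analyticOn := analyticOnNhd_id
  isOpen_image := by rw [image_id]; exact A.isOpen_Ut
  exists_analytic_inv := ⟨id, analyticOnNhd_id, fun _ _ => rfl⟩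
  comp_p := fun _ _ => by rw [hp, id]

/-- Group elements are embeddings of a uniformizing system into itself. -/
lemma of_mem_G {g : CC n → CC n} (hg : g ∈ P.G) : IsUSEmbedding P P g := by
  obtain ⟨g', hg', hl, hr⟩ := P.inv_mem_G g hg
  have himage : g '' P.Ut = P.Ut := (P.mapsTo_G g hg).image_subset.antisymm
    fun x hx => ⟨g' x, P.mapsTo_G g' hg' hx, hr x⟩
  exact
    { mapsTo := P.mapsTo_G g hg
      injOn := (Function.LeftInverse.injective hl).injOn
      analyticOn := P.analytic_G g hg
      isOpen_image := himage.symm ▸ P.isOpen_Ut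
      exists_analytic_inv := ⟨g', himage.symm ▸ P.analytic_G g' hg', fun x _ => hl x⟩
      comp_p := P.invariant_p g hg }

/-- A restriction of `P` to a set contained in the image of an embedding `A → P` embeds
into `A`. -/
lemma exists_of_subset_image (hl : IsUSEmbedding A P l) (hB : B.Ut ⊆ l '' A.Ut)
    (hp : B.p = P.p) : ∃ k, IsUSEmbedding B A k := by
  obtain ⟨k, hk, hkl⟩ := hl.exists_analytic_inv
  have hlk : ∀ y ∈ B.Ut, l (k y) = y := by
    intro y hy
    obtain ⟨x, hx, rfl⟩ := hB hy
    rw [hkl x hx]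
  have hmaps : MapsTo k B.Ut A.Ut := by
    intro y hy
    obtain ⟨x, hx, rfl⟩ := hB hy
    rwa [hkl x hx]
  refine ⟨k, hmaps, LeftInvOn.injOn hlk, hk.mono hB, ?_, ⟨l, ?_, hlk⟩, fun y hy => ?_⟩
  · suffices h : k '' B.Ut = A.Ut ∩ l ⁻¹' B.Ut from
      h ▸ hl.analyticOn.continuousOn.isOpen_inter_preimage A.isOpen_Ut B.isOpen_Ut
    ext x
    constructor
    · rintro ⟨y, hy, rfl⟩
      exact ⟨hmaps hy, by rwa [mem_preimage, hlk y hy]⟩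
    · rintro ⟨hx, hlx⟩
      exact ⟨l x, hlx, hkl x hx⟩
  · exact hl.analyticOn.mono hmaps.image_subset
  · rw [← hl.comp_p _ (hmaps hy), hlk y hy, hp]

/-- Any two uniformizing systems embedding into a third one have, around each common point, a
common restriction. -/
theorem exists_common (hl : IsUSEmbedding A P l) (hm : IsUSEmbedding B P m) {x : X}
    (hxA : x ∈ A.U) (hxB : x ∈ B.U) :
    ∃ W : UniformizingSystem n X, x ∈ W.U ∧ W.Ut ⊆ P.Ut ∧ W.p = P.p ∧
      (∃ k, IsUSEmbedding W A k) ∧ ∃ k, IsUSEmbedding W B k := by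
  obtain ⟨y, hy, rfl⟩ := hxA
  obtain ⟨z, hz, hzy⟩ := hxB
  obtain ⟨g, hg, hgz⟩ := P.exists_g_of_p_eq (m z) (hm.mapsTo hz) (l y) (hl.mapsTo hy)
    (by rw [hm.comp_p z hz, hl.comp_p y hy, hzy])
  have hgm := (of_mem_G hg).comp hm
  obtain ⟨W, hyW, hWN, hWP, hWp⟩ := P.exists_restriction (hl.mapsTo hy)
    (hl.isOpen_image.inter hgm.isOpen_image) ⟨mem_image_of_mem l hy, z, hz, hgz⟩
  refine ⟨W, ⟨l y, hyW, by rw [hWp, hl.comp_p y hy]⟩, hWP, hWp,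
    hl.exists_of_subset_image (fun w hw => (hWN hw).1) hWp,
    hgm.exists_of_subset_image (fun w hw => (hWN hw).2) hWp⟩

end IsUSEmbedding

namespace OrbifoldAtlas

variable {n : ℕ} {X : Type*} [TopologicalSpace X]

/-- Uniformizing systems embedding into charts of one atlas are compatible; the common restriction
may be chosen as a restriction of a chart of the atlas. -/
theorem exists_common_restriction (𝒰 : OrbifoldAtlas n X) {A B : UniformizingSystem n X}
    {i j : 𝒰.I} {l m : CC n → CC n} (hl : IsUSEmbedding A (𝒰.chart i) l)
    (hm : IsUSEmbedding B (𝒰.chart j) m) {x : X} (hxA : x ∈ A.U) (hxB : x ∈ B.U) :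
    ∃ (k : 𝒰.I) (W : UniformizingSystem n X), x ∈ W.U ∧ W.Ut ⊆ (𝒰.chart k).Ut ∧
      W.p = (𝒰.chart k).p ∧ (∃ f, IsUSEmbedding W A f) ∧ ∃ f, IsUSEmbedding W B f := by
  obtain ⟨k, hxk, -, ⟨e, he⟩, ⟨e', he'⟩⟩ := 𝒰.compat i j x ⟨hl.U_subset hxA, hm.U_subset hxB⟩
  obtain ⟨C, hxC, -, -, ⟨a, ha⟩, ⟨c, hc⟩⟩ := hl.exists_common he hxA hxk
  obtain ⟨D, hxD, -, -, ⟨b, hb⟩, ⟨d, hd⟩⟩ := hm.exists_common he' hxB hxk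
  obtain ⟨W, hxW, hWk, hWp, ⟨s, hs⟩, ⟨t, ht⟩⟩ := hc.exists_common hd hxC hxD
  exact ⟨k, W, hxW, hWk, hWp, ⟨_, ha.comp hs⟩, ⟨_, hb.comp ht⟩⟩

/-- The restriction of the chart `t.1` of `𝒰` to `t.2` is a uniformizing system that embeds into
a chart of `𝒱`. -/
def IsCommonRestriction (𝒰 𝒱 : OrbifoldAtlas n X) (t : 𝒰.I × Set (CC n))
    (W : UniformizingSystem n X) : Prop :=
  W.Ut = t.2 ∧ W.Ut ⊆ (𝒰.chart t.1).Ut ∧ W.p = (𝒰.chart t.1).p ∧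
    ∃ (j : 𝒱.I) (l : CC n → CC n), IsUSEmbedding W (𝒱.chart j) l

/-- The atlas of all restrictions of charts of `𝒰` that embed into charts of `𝒱`. -/
def commonRefinement (𝒰 𝒱 : OrbifoldAtlas n X) (h : AtlasEquiv 𝒰 𝒱) : OrbifoldAtlas n X where
  I := {t : 𝒰.I × Set (CC n) // ∃ W, IsCommonRestriction 𝒰 𝒱 t W}
  chart t := t.2.choose
  covers x := by
    obtain ⟨W, i, j, l, l', hxW, hl, hl'⟩ := h x
    obtain ⟨S, hxS, hSi, hSp, ⟨k, hk⟩, -⟩ := hl.exists_common hl hxW hxW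
    have hS : ∃ W, IsCommonRestriction 𝒰 𝒱 (i, S.Ut) W :=
      ⟨S, rfl, hSi, hSp, j, _, hl'.comp hk⟩
    refine ⟨⟨(i, S.Ut), hS⟩, ?_⟩
    obtain ⟨hUt, -, hp, -⟩ := hS.choose_spec
    exact (IsUSEmbedding.of_subset hUt.ge (hSp.trans hp.symm)).U_subset hxS
  compat s t x hx := by
    obtain ⟨-, hs, hsp, js, es, hes⟩ := s.2.choose_spec
    obtain ⟨-, ht, htp, -⟩ := t.2.choose_spec
    obtain ⟨k, W, hxW, hWk, hWp, ⟨a, ha⟩, ⟨b, hb⟩⟩ := 𝒰.exists_common_restriction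
      (IsUSEmbedding.of_subset hs hsp) (IsUSEmbedding.of_subset ht htp) hx.1 hx.2
    have hW : ∃ W', IsCommonRestriction 𝒰 𝒱 (k, W.Ut) W' :=
      ⟨W, rfl, hWk, hWp, js, _, hes.comp ha⟩
    obtain ⟨hUt, -, hp, -⟩ := hW.choose_spec
    have hto := IsUSEmbedding.of_subset hUt.le (hp.trans hWp.symm)
    exact ⟨⟨(k, W.Ut), hW⟩,
      (IsUSEmbedding.of_subset hUt.ge (hWp.trans hp.symm)).U_subset hxW,
      subset_inter (ha.comp hto).U_subset (hb.comp hto).U_subset,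
      ⟨_, ha.comp hto⟩, ⟨_, hb.comp hto⟩⟩

end OrbifoldAtlas

/-- Two orbifold atlases on `X` are equivalent if and only if they admit a common
refinement. -/
theorem statement9 {n : ℕ} {X : Type*} [TopologicalSpace X] [T2Space X]
    [SecondCountableTopology X] [ParacompactSpace X]
    (𝒰 𝒱 : OrbifoldAtlas n X) :
    AtlasEquiv 𝒰 𝒱 ↔ ∃ 𝒲 : OrbifoldAtlas n X, Refines 𝒲 𝒰 ∧ Refines 𝒲 𝒱 := by
  constructor
  · intro h
    refine ⟨𝒰.commonRefinement 𝒱 h, fun t => ?_, fun t => t.2.choose_spec.2.2.2⟩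
    obtain ⟨-, ht, hp, -⟩ := t.2.choose_spec
    exact ⟨t.1.1, id, .of_subset ht hp⟩
  · rintro ⟨𝒲, h𝒰, h𝒱⟩ x
    obtain ⟨k, hxk⟩ := 𝒲.covers x
    obtain ⟨i, l, hl⟩ := h𝒰 k
    obtain ⟨j, l', hl'⟩ := h𝒱 k
    exact ⟨𝒲.chart k, i, j, l, l', hxk, hl, hl'⟩
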